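/- Let n ≥ 2, let m ∈ {−1,+1}^n, let C ≥ 0, and let M ∈ Sym₀(ℝ^n) be the matrix with M_{ij} = −C·m_i·m_j for all i ≠ j. Then the optimal gate time is T(M) = C·n if n is odd and T(M) = C·(n−1) if n is even. -/

import Mathlib

/-- The sign `m = (−1)^b` of a bit: encodings `m ∈ {−1,+1}^n` are represented by
boolean vectors `b : Fin n → Bool` via `m i = sgn (b i)`. -/
def sgn (b : Bool) : ℝ := if b then -1 else 1

/-- `lam` is a feasible decomposition of `M ∈ Sym₀(ℝ^n)`:
`lam ≥ 0` and `M i j = Σ_{m ∈ {−1,+1}^n} lam m * m_i * m_j` for all `i ≠ j`. -/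
def IsDecomp {n : ℕ} (M : Matrix (Fin n) (Fin n) ℝ)
    (lam : (Fin n → Bool) → ℝ) : Prop :=
  (∀ m, 0 ≤ lam m) ∧
  ∀ i j : Fin n, i ≠ j →
    M i j = ∑ m : Fin n → Bool, lam m * sgn (m i) * sgn (m j)

/-- The optimal gate time `T(M)`: infimum of `Σ_m lam m` over feasible decompositions. -/
noncomputable def gateTime {n : ℕ} (M : Matrix (Fin n) (Fin n) ℝ) : ℝ :=
  sInf { t | ∃ lam, IsDecomp M lam ∧ ∑ m : Fin n → Bool, lam m = t }


theorem sgn_mul_self (a : Bool) : sgn a * sgn a = 1 := by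
  cases a <;> simp [sgn]

theorem sgn_xor (a b : Bool) : sgn (xor a b) = sgn a * sgn b := by
  cases a <;> cases b <;> simp [sgn]

/-- A sum of an odd number of signs is at least `1` in absolute value. -/
theorem one_le_sq_sum_sgn {n : ℕ} (hn : Odd n) (b : Fin n → Bool) :
    1 ≤ (∑ i, sgn (b i)) ^ 2 := by
  have hsum : ∑ i, sgn (b i)
      = (((n : ℤ) - 2 * ∑ i, (if b i then (1 : ℤ) else 0) : ℤ) : ℝ) := by
    have hterm : ∀ i, sgn (b i) = 1 - 2 * (if b i then (1 : ℝ) else 0) := by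
      intro i
      cases b i <;> norm_num [sgn]
    simp only [hterm, Finset.sum_sub_distrib, ← Finset.mul_sum]
    push_cast
    simp
  rw [hsum]
  generalize (∑ i, (if b i then (1 : ℤ) else 0)) = k
  have hne : (n : ℤ) - 2 * k ≠ 0 := by
    obtain ⟨r, rfl⟩ := hn
    omega
  have hpos : (1 : ℤ) ≤ ((n : ℤ) - 2 * k) ^ 2 := by
    have := sq_pos_of_ne_zero hne
    omega
  exact_mod_cast hpos

/-- The least possible value of the square of a sum of `n` signs. -/
noncomputable def minSqSum (n : ℕ) : ℝ := if Odd n then 1 else 0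

theorem minSqSum_le {n : ℕ} (b : Fin n → Bool) : minSqSum n ≤ (∑ i, sgn (b i)) ^ 2 := by
  unfold minSqSum
  split_ifs with h
  · exact one_le_sq_sum_sgn h b
  · positivity

theorem exists_sq_sum_sgn_eq (n : ℕ) :
    ∃ b : Fin n → Bool, (∑ i, sgn (b i)) ^ 2 = minSqSum n := by
  refine ⟨fun i => decide (Odd i.val), ?_⟩
  have hterm : ∀ k : ℕ, sgn (decide (Odd k)) = (-1 : ℝ) ^ k := by
    intro k
    rcases Nat.even_or_odd k with h | h
    · simp [sgn, h.neg_one_pow, Nat.not_odd_iff_even.mpr h]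
    · simp [sgn, h.neg_one_pow, h]
  simp only [hterm]
  rw [Fin.sum_univ_eq_sum_range (fun k => (-1 : ℝ) ^ k) n, neg_one_geom_sum, minSqSum]
  by_cases h : Even n
  · simp [h, Nat.not_odd_iff_even.mpr h]
  · simp [h, Nat.not_even_iff_odd.mp h]

theorem exists_perm_map_pair {α : Type*} [DecidableEq α] {i j k l : α} (hij : i ≠ j)
    (hkl : k ≠ l) : ∃ σ : Equiv.Perm α, σ i = k ∧ σ j = l := by
  refine ⟨Equiv.swap (Equiv.swap i k j) l * Equiv.swap i k, ?_, ?_⟩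
  · have hne : k ≠ Equiv.swap i k j := fun h =>
      hij ((Equiv.swap i k).injective (by rw [Equiv.swap_apply_left]; exact h))
    rw [Equiv.Perm.mul_apply, Equiv.swap_apply_left, Equiv.swap_apply_of_ne_of_ne hne hkl]
  · rw [Equiv.Perm.mul_apply, Equiv.swap_apply_left]

/-- The pair correlations of a permutation-invariant weight agree for all pairs of distinct
indices. -/
theorem pairCorr_eq {n : ℕ} {f : (Fin n → Bool) → ℝ}
    (hf : ∀ (σ : Equiv.Perm (Fin n)) b, f (b ∘ σ) = f b) {i j k l : Fin n}
    (hij : i ≠ j) (hkl : k ≠ l) :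
    ∑ b, f b * sgn (b i) * sgn (b j) = ∑ b, f b * sgn (b k) * sgn (b l) := by
  obtain ⟨σ, hi, hj⟩ := exists_perm_map_pair hij hkl
  rw [← (Equiv.arrowCongr σ.symm (Equiv.refl Bool)).sum_comp]
  refine Finset.sum_congr rfl fun b _ => ?_
  have hb : Equiv.arrowCongr σ.symm (Equiv.refl Bool) b = b ∘ σ := by
    ext x
    simp
  rw [hb, hf, Function.comp_apply, Function.comp_apply, hi, hj]

/-- Summing all pair correlations gives the second moment of the sum of the signs. -/
theorem sum_sum_pairCorr {n : ℕ} (f : (Fin n → Bool) → ℝ) :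
    ∑ i, ∑ j, ∑ b, f b * sgn (b i) * sgn (b j) = ∑ b, f b * (∑ i, sgn (b i)) ^ 2 := by
  rw [Finset.sum_congr rfl fun i _ => Finset.sum_comm, Finset.sum_comm]
  refine Finset.sum_congr rfl fun b _ => ?_
  rw [sq, Finset.sum_mul_sum, Finset.mul_sum]
  simp only [Finset.mul_sum, mul_assoc]

/-- If all off-diagonal pair correlations equal `a`, the second moment of the sum of the signs
is determined by `a` and the total weight. -/
theorem second_moment_eq {n : ℕ} (f : (Fin n → Bool) → ℝ) (a : ℝ)
    (ha : ∀ i j, i ≠ j → ∑ b, f b * sgn (b i) * sgn (b j) = a) :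
    ∑ b, f b * (∑ i, sgn (b i)) ^ 2 = n * (∑ b, f b) + n * (n - 1) * a := by
  rw [← sum_sum_pairCorr]
  have hentry : ∀ i j, ∑ b, f b * sgn (b i) * sgn (b j)
      = a + if i = j then ∑ b, f b - a else 0 := by
    intro i j
    split_ifs with h
    · subst h
      simp [mul_assoc, sgn_mul_self]
    · rw [ha i j h, add_zero]
  simp only [hentry, Finset.sum_add_distrib, Finset.sum_ite_eq, Finset.mem_univ, if_true,
    Finset.sum_const, Finset.card_univ, Fintype.card_fin, nsmul_eq_mul]
  ring

theorem sum_comp_xor {n : ℕ} (d : Fin n → Bool) (g : (Fin n → Bool) → ℝ) :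
    ∑ b : Fin n → Bool, g (fun i => xor (b i) (d i)) = ∑ b, g b := by
  have hinv : Function.Involutive fun (b : Fin n → Bool) i => xor (b i) (d i) := by
    intro b
    ext i
    simp
  exact Equiv.sum_comp (hinv.toPerm _) g

/-- Twisting a weight by `d` twists its pair correlations by the signs of `d`. -/
theorem pairCorr_twist {n : ℕ} (d : Fin n → Bool) (f : (Fin n → Bool) → ℝ) (i j : Fin n) :
    ∑ b : Fin n → Bool, f (fun k => xor (b k) (d k)) * sgn (b i) * sgn (b j)
      = sgn (d i) * sgn (d j) * ∑ b, f b * sgn (b i) * sgn (b j) := by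
  rw [← sum_comp_xor d fun b => f b * sgn (b i) * sgn (b j), Finset.mul_sum]
  refine Finset.sum_congr rfl fun b _ => ?_
  rw [sgn_xor, sgn_xor]
  linear_combination (-(f (fun k => xor (b k) (d k)) * sgn (b i) * sgn (b j)) *
    sgn (d j) * sgn (d j)) * sgn_mul_self (d i) -
    (f (fun k => xor (b k) (d k)) * sgn (b i) * sgn (b j)) * sgn_mul_self (d j)

/-- A weight attaining the bound `le_total_weight`. -/
theorem exists_weight {n : ℕ} (hn : 2 ≤ n) {C : ℝ} (hC : 0 ≤ C) :
    ∃ f : (Fin n → Bool) → ℝ, (∀ b, 0 ≤ f b) ∧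
      (∀ i j, i ≠ j → ∑ b, f b * sgn (b i) * sgn (b j) = -C) ∧
      (n - minSqSum n) * ∑ b, f b = C * (n * (n - 1)) := by
  classical
  set g : (Fin n → Bool) → ℝ := fun b => if (∑ i, sgn (b i)) ^ 2 = minSqSum n then 1 else 0
    with hg
  have hg0 : ∀ b, 0 ≤ g b := fun b => by
    simp only [hg]
    split_ifs <;> norm_num
  have hginv : ∀ (σ : Equiv.Perm (Fin n)) b, g (b ∘ σ) = g b := fun σ b => by
    simp only [hg, Function.comp_apply, Equiv.sum_comp σ fun i => sgn (b i)]
  have hgpos : 0 < ∑ b, g b := by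
    obtain ⟨b, hb⟩ := exists_sq_sum_sgn_eq n
    exact Finset.sum_pos' (fun b _ => hg0 b) ⟨b, Finset.mem_univ b, by simp [hg, hb]⟩
  obtain ⟨a, ha⟩ : ∃ a, ∀ i j, i ≠ j → ∑ b, g b * sgn (b i) * sgn (b j) = a :=
    ⟨_, fun i j hij => pairCorr_eq hginv hij
      (show (⟨0, by omega⟩ : Fin n) ≠ ⟨1, by omega⟩ by simp)⟩
  have hmom := second_moment_eq g a ha
  have hmom' : ∑ b, g b * (∑ i, sgn (b i)) ^ 2 = minSqSum n * ∑ b, g b := by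
    rw [Finset.mul_sum]
    refine Finset.sum_congr rfl fun b _ => ?_
    simp only [hg]
    split_ifs with h
    · rw [h]; ring
    · ring
  have hn' : (2 : ℝ) ≤ n := by exact_mod_cast hn
  have hq : minSqSum n ≤ 1 := by
    unfold minSqSum
    split_ifs <;> norm_num
  have hrel : (n - minSqSum n) * ∑ b, g b = -a * (n * (n - 1)) := by
    linear_combination hmom' - hmom
  have ha0 : 0 < -a := by
    have hl : 0 < (n - minSqSum n) * ∑ b, g b := mul_pos (by linarith) hgpos
    rw [hrel] at hl
    exact pos_of_mul_pos_left hl (mul_nonneg (by linarith) (by linarith))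
  have ha' : a ≠ 0 := (neg_pos.mp ha0).ne
  refine ⟨fun b => C / -a * g b, fun b => mul_nonneg (div_nonneg hC ha0.le) (hg0 b), ?_, ?_⟩
  · intro i j hij
    simp only [mul_assoc (C / -a), ← Finset.mul_sum]
    rw [ha i j hij]
    field_simp
  · rw [← Finset.mul_sum, mul_left_comm, hrel]
    field_simp

/-- Lower bound on the total weight when all off-diagonal correlations equal `-C`. -/
theorem le_total_weight {n : ℕ} {C : ℝ} {f : (Fin n → Bool) → ℝ} (hf : ∀ b, 0 ≤ f b)
    (hcorr : ∀ i j, i ≠ j → ∑ b, f b * sgn (b i) * sgn (b j) = -C) :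
    C * (n * (n - 1)) ≤ (n - minSqSum n) * ∑ b, f b := by
  have hmom := second_moment_eq f (-C) hcorr
  have hle : minSqSum n * ∑ b, f b ≤ ∑ b, f b * (∑ i, sgn (b i)) ^ 2 := by
    rw [Finset.mul_sum]
    refine Finset.sum_le_sum fun b _ => ?_
    rw [mul_comm]
    exact mul_le_mul_of_nonneg_left (minSqSum_le b) (hf b)
  linarith

/-- for `n ≥ 2`, `m ∈ {−1,+1}^n`, `C ≥ 0` and `M ∈ Sym₀(ℝ^n)` with
`M_{ij} = −C·m_i·m_j` for `i ≠ j`, the optimal gate time is `T(M) = C·n` for odd `n`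
and `T(M) = C·(n−1)` for even `n`. -/
theorem stmt_16 {n : ℕ} (hn : 2 ≤ n) (m : Fin n → ℝ)
    (hm : ∀ i, m i = 1 ∨ m i = -1) (C : ℝ) (hC : 0 ≤ C)
    (M : Matrix (Fin n) (Fin n) ℝ)
    (hM : ∀ i j : Fin n, M i j = if i = j then 0 else -C * (m i * m j)) :
    gateTime M = if Odd n then C * (n : ℝ) else C * ((n : ℝ) - 1) := by
  obtain ⟨d, hd⟩ : ∃ d : Fin n → Bool, ∀ i, m i = sgn (d i) := by
    refine Classical.skolem (p := fun i (c : Bool) => m i = sgn c) |>.mp fun i => ?_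
    rcases hm i with h | h
    · exact ⟨false, by simp [h, sgn]⟩
    · exact ⟨true, by simp [h, sgn]⟩
  have hn' : (2 : ℝ) ≤ n := by exact_mod_cast hn
  have hq : 0 < (n : ℝ) - minSqSum n := by
    unfold minSqSum
    split_ifs <;> linarith
  have hT : (n - minSqSum n) * (if Odd n then C * (n : ℝ) else C * ((n : ℝ) - 1))
      = C * (n * (n - 1)) := by
    unfold minSqSum
    split_ifs <;> ring
  refine IsLeast.csInf_eq ⟨?_, ?_⟩
  · obtain ⟨f, hf, hcorr, htot⟩ := exists_weight hn hC
    refine ⟨fun b => f fun k => xor (b k) (d k), ⟨fun b => hf _, fun i j hij => ?_⟩, ?_⟩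
    · rw [pairCorr_twist, hcorr i j hij, hM, if_neg hij, hd, hd]
      ring
    · rw [sum_comp_xor d f]
      exact mul_left_cancel₀ hq.ne' (htot.trans hT.symm)
  · rintro t ⟨lam, ⟨hpos, hlam⟩, rfl⟩
    have hle := le_total_weight (C := C) (f := fun b => lam fun k => xor (b k) (d k))
      (fun b => hpos _) fun i j hij => by
        rw [pairCorr_twist, ← hlam i j hij, hM, if_neg hij, hd, hd]
        linear_combination (-C * sgn (d j) * sgn (d j)) * sgn_mul_self (d i)
          - C * sgn_mul_self (d j)
    rw [sum_comp_xor d lam, ← hT] at hle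
    exact le_of_mul_le_mul_left hle hq
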